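/- If B is a transcendence base of ℝ over ℚ, θ is an irrational real number that is algebraic over ℚ, and X ⊆ B, then the set (B \ X) ∪ {xθ : x ∈ X} is again a transcendence base of ℝ over ℚ. -/

import Mathlib

noncomputable section

open Set Cardinal

/-- A Cantor set: a nonempty compact subset of ℝ that is totally disconnected
and dense in itself (no isolated points). -/
def IsCantorSet (C : Set ℝ) : Prop :=
  C.Nonempty ∧ IsCompact C ∧ IsTotallyDisconnected C ∧ Preperfect C

/-- A set `S ⊆ ℝ` is algebraically independent (over ℚ). -/
def AlgIndepSet (S : Set ℝ) : Prop := AlgebraicIndependent ℚ ((↑) : S → ℝ)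

/-- A transcendence base of ℝ over ℚ: a maximal algebraically independent subset. -/
def IsTransBase (S : Set ℝ) : Prop :=
  AlgIndepSet S ∧ ∀ x : ℝ, x ∉ S → ¬ AlgIndepSet (insert x S)

open AlgebraicIndependent in
theorem isTransBase_iff_isBase {S : Set ℝ} : IsTransBase S ↔ (matroid ℚ ℝ).IsBase S := by
  rw [Matroid.isBase_iff_maximal_indep,
    maximal_iff_forall_insert fun _ _ h hst => Matroid.Indep.subset h hst]
  rfl

open AlgebraicIndependent in
theorem mul_mem_closure_of_isAlgebraic {S : Set ℝ} {a θ : ℝ} (ha : a ∈ (matroid ℚ ℝ).closure S)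
    (hθ : IsAlgebraic ℚ θ) : a * θ ∈ (matroid ℚ ℝ).closure S := by
  rw [matroid_closure_eq] at ha ⊢
  exact mul_mem ha (hθ.extendScalars (algebraMap ℚ (Algebra.adjoin ℚ S)).injective)

/-- If every element of a base is replaced by an element parallel to it, the result is a base. -/
theorem Matroid.IsBase.image_of_mem_closure {α : Type*} {M : Matroid α} {B : Set α}
    (hB : M.IsBase B) {f : α → α} (hf : ∀ S ⊆ B, ∀ b ∈ S, f b ∈ M.closure S)
    (hf' : ∀ b ∈ B, b ∈ M.closure (f '' B)) : M.IsBase (f '' B) := by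
  have hE : f '' B ⊆ M.E := by
    rintro _ ⟨b, hb, rfl⟩
    exact M.closure_subset_ground _ (hf B subset_rfl b hb)
  have hspan : M.Spanning (f '' B) := by
    rw [Matroid.spanning_iff_ground_subset_closure hE, ← hB.closure_eq]
    exact M.closure_subset_closure_of_subset_closure hf'
  obtain ⟨C, hC, hCB⟩ := hspan.exists_isBase_subset
  suffices f '' B ⊆ C from hCB.antisymm this ▸ hC
  rintro _ ⟨b, hb, rfl⟩
  by_contra hbC
  have hsub : C ⊆ M.closure (B \ {b}) := by
    intro c hc
    obtain ⟨d, hd, rfl⟩ := hCB hc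
    refine hf _ sdiff_subset d ⟨hd, ?_⟩
    rintro rfl
    exact hbC hc
  refine hB.indep.notMem_closure_sdiff_of_mem hb ?_
  have := M.closure_subset_closure_of_subset_closure hsub
  rw [hC.closure_eq] at this
  exact this (hB.subset_ground hb)

/-- Replacing a part X of a transcendence base B by {xθ : x ∈ X}, for θ an
irrational algebraic number, again yields a transcendence base. -/
theorem transBase_mul_algebraic_irrational (B : Set ℝ) (hB : IsTransBase B)
    (θ : ℝ) (hθirr : Irrational θ) (hθalg : IsAlgebraic ℚ θ)
    (X : Set ℝ) (hX : X ⊆ B) :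
    IsTransBase ((B \ X) ∪ (fun x => x * θ) '' X) := by
  classical
  rw [isTransBase_iff_isBase] at hB ⊢
  have himage : (B \ X) ∪ (fun x => x * θ) '' X = (fun x => if x ∈ X then x * θ else x) '' B := by
    ext y
    constructor
    · rintro (⟨hy, hyX⟩ | ⟨x, hx, rfl⟩)
      · exact ⟨y, hy, if_neg hyX⟩
      · exact ⟨x, hX hx, if_pos hx⟩
    · rintro ⟨x, hx, rfl⟩
      by_cases hxX : x ∈ X
      · exact Or.inr ⟨x, hxX, (if_pos hxX).symm⟩
      · simp only [if_neg hxX]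
        exact Or.inl ⟨hx, hxX⟩
  have hmem {S : Set ℝ} {x : ℝ} (hx : x ∈ S) :
      x ∈ (AlgebraicIndependent.matroid ℚ ℝ).closure S :=
    Matroid.mem_closure_of_mem _ hx (subset_univ _)
  rw [himage]
  refine hB.image_of_mem_closure (fun S _ b hb => ?_) fun b hb => ?_
  · split_ifs
    · exact mul_mem_closure_of_isAlgebraic (hmem hb) hθalg
    · exact hmem hb
  · have h := hmem (mem_image_of_mem (fun x => if x ∈ X then x * θ else x) hb)
    split_ifs at h
    · simpa only [mul_inv_cancel_right₀ hθirr.ne_zero] using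
        mul_mem_closure_of_isAlgebraic h hθalg.inv
    · exact h
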